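/- arXiv:1202.4739 — 7 statements merged into one kernel-verified Lean document; each statement's English description precedes it below -/
import Mathlib

section
/- Let α, β be nonzero real numbers, and let a, b, c, d be real numbers. If a·cos(αt) + b·sin(αt) + c·cos(βt) + d·sin(βt) = 0 for all t ∈ ℝ, and α/β is irrational, then a = b = c = d = 0. -/
/-- Differentiating a vanishing trigonometric sum with two frequencies. -/
theorem trig_sum_deriv_eq_zero {α β a b c d : ℝ}
    (h : ∀ t : ℝ, a * Real.cos (α * t) + b * Real.sin (α * t)
      + c * Real.cos (β * t) + d * Real.sin (β * t) = 0) (t : ℝ) :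
    b * α * Real.cos (α * t) + -(a * α) * Real.sin (α * t)
      + d * β * Real.cos (β * t) + -(c * β) * Real.sin (β * t) = 0 := by
  have hlin (γ : ℝ) : HasDerivAt (fun s : ℝ => γ * s) γ t := by
    simpa using (hasDerivAt_id t).const_mul γ
  have hsum := ((((hlin α).cos.const_mul a).add ((hlin α).sin.const_mul b)).add
    ((hlin β).cos.const_mul c)).add ((hlin β).sin.const_mul d)
  have hzero := hsum.unique ((hasDerivAt_const t (0 : ℝ)).congr_of_eventuallyEq
    (Filter.Eventually.of_forall h))
  linear_combination hzero

/-- If `a·cos(αt) + b·sin(αt) + c·cos(βt) + d·sin(βt) = 0` for all `t`, with `α, β ≠ 0`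
and `α/β` irrational, then `a = b = c = d = 0`. -/
theorem trig_linear_independence (α β a b c d : ℝ) (hα : α ≠ 0) (hβ : β ≠ 0)
    (hirr : Irrational (α / β))
    (h : ∀ t : ℝ, a * Real.cos (α * t) + b * Real.sin (α * t)
      + c * Real.cos (β * t) + d * Real.sin (β * t) = 0) :
    a = 0 ∧ b = 0 ∧ c = 0 ∧ d = 0 := by
  have hsq : α ^ 2 - β ^ 2 ≠ 0 := by
    intro heq
    rcases sq_eq_sq_iff_eq_or_eq_neg.mp (sub_eq_zero.mp heq) with rfl | rfl
    · exact hirr.ne_one (div_self hβ)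
    · exact hirr.ne_int (-1) (by rw [neg_div, div_self hβ]; norm_num)
  have h₁ := trig_sum_deriv_eq_zero h
  have h₂ := trig_sum_deriv_eq_zero h₁
  have h₃ := trig_sum_deriv_eq_zero h₂
  have e₀ := h 0
  have e₁ := h₁ 0
  have e₂ := h₂ 0
  have e₃ := h₃ 0
  simp only [mul_zero, Real.cos_zero, Real.sin_zero, mul_one, add_zero] at e₀ e₁ e₂ e₃
  have ha : a = 0 := (mul_eq_zero.mp
    (show a * (α ^ 2 - β ^ 2) = 0 by linear_combination -e₂ - β ^ 2 * e₀)).resolve_right hsq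
  have hb : b = 0 := ((mul_eq_zero.mp ((mul_eq_zero.mp
    (show b * α * (α ^ 2 - β ^ 2) = 0 by
      linear_combination -e₃ - β ^ 2 * e₁)).resolve_right hsq)).resolve_right hα)
  subst ha hb
  exact ⟨rfl, rfl, by simpa using e₀, by simpa [hβ] using e₁⟩
end

section
/- Let α, β be nonzero real numbers with α/β irrational, and for p = (w₀, x₀, y₀, z₀) ∈ ℝ⁴ define the curve 𝔮(t) = (w₀·cos(αt) − x₀·sin(αt), w₀·sin(αt) + x₀·cos(αt), y₀·cos(βt) − z₀·sin(βt), y₀·sin(βt) + z₀·cos(βt)). Suppose p lies on the unit sphere S³ = {q ∈ ℝ⁴ : q·q = 1}. Then there exists (A, B, C, D) ≠ (0,0,0,0) in ℝ⁴ with A·𝔮₁(t) + B·𝔮₂(t) + C·𝔮₃(t) + D·𝔮₄(t) = 0 for all t ∈ ℝ if and only if p ∈ C₁ ∪ C₂, where C₁ = {(0,0,y,z) : y² + z² = 1} and C₂ = {(w,x,0,0) : w² + x² = 1}. -/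
open Real

/-- A vanishing sinusoid of nonzero frequency has vanishing coefficients. -/
theorem coeffs_eq_zero_of_sinusoid_eq_zero {α a b : ℝ} (hα : α ≠ 0)
    (h : ∀ t : ℝ, a * cos (α * t) + b * sin (α * t) = 0) : a = 0 ∧ b = 0 := by
  refine ⟨by simpa using h 0, ?_⟩
  have h' := h (π / 2 / α)
  rw [mul_div_cancel₀ _ hα] at h'
  simpa using h'

/-- If the sum of two sinusoids with incommensurable frequencies vanishes identically, then
so does the first one. -/
theorem sinusoid_eq_zero_of_add_eq_zero {α β a b c d : ℝ} (hβ : β ≠ 0)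
    (hirr : Irrational (α / β))
    (h : ∀ t : ℝ, a * cos (α * t) + b * sin (α * t) +
      (c * cos (β * t) + d * sin (β * t)) = 0) (t : ℝ) :
    a * cos (α * t) + b * sin (α * t) = 0 := by
  -- `s` is a period of the second sinusoid but not of the first
  set s : ℝ := 2 * π / β with hs
  have hβs : β * s = 2 * π := mul_div_cancel₀ _ hβ
  have hαs : cos (α * s) ≠ 1 := by
    intro h1
    obtain ⟨n, hn⟩ := (cos_eq_one_iff _).1 h1
    refine hirr ⟨n, ?_⟩
    have : (n : ℝ) * (2 * π) = α / β * (2 * π) := by rw [hn, hs]; ring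
    simpa using mul_right_cancel₀ two_pi_pos.ne' this
  have h0 := h t
  have hadd := h (t + s)
  have hsub := h (t - s)
  simp only [mul_add, mul_sub, hβs, cos_add, sin_add, cos_sub, sin_sub, cos_two_pi,
    sin_two_pi] at hadd hsub
  have hmul : (cos (α * s) - 1) * (a * cos (α * t) + b * sin (α * t)) = 0 := by
    linear_combination (hadd + hsub) / 2 - h0
  exact (mul_eq_zero.1 hmul).resolve_left (sub_ne_zero.2 hαs)

/-- A vector of the plane orthogonal to a nonzero vector `(u, v)` and to its quarter turn
`(-v, u)` is zero. -/
theorem eq_zero_of_rotated_coeffs_eq_zero {A B u v : ℝ} (huv : ¬ (u = 0 ∧ v = 0))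
    (h₁ : A * u + B * v = 0) (h₂ : B * u - A * v = 0) : A = 0 ∧ B = 0 := by
  have huv' : u ^ 2 + v ^ 2 ≠ 0 := fun h ↦ huv ⟨by nlinarith, by nlinarith⟩
  constructor
  · refine (mul_eq_zero.1 (?_ : A * (u ^ 2 + v ^ 2) = 0)).resolve_right huv'
    linear_combination u * h₁ - v * h₂
  · refine (mul_eq_zero.1 (?_ : B * (u ^ 2 + v ^ 2) = 0)).resolve_right huv'
    linear_combination v * h₁ + u * h₂

/-- For a point `p = (w₀,x₀,y₀,z₀)` of the unit sphere `S³ ⊂ ℝ⁴` and `α, β ≠ 0` with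
`α/β` irrational, the rotated curve `𝔮(t)` lies in some hyperplane of `ℝ⁴` through the
origin if and only if `p` lies on one of the two complementary great circles
`C₁ = {(0,0,y,z) : y² + z² = 1}` and `C₂ = {(w,x,0,0) : w² + x² = 1}`. -/
theorem orbit_in_hyperplane_iff_on_complementary_circle
    (α β : ℝ) (hα : α ≠ 0) (hβ : β ≠ 0) (hirr : Irrational (α / β))
    (w₀ x₀ y₀ z₀ : ℝ) (hp : w₀ ^ 2 + x₀ ^ 2 + y₀ ^ 2 + z₀ ^ 2 = 1)
    (q : ℝ → Fin 4 → ℝ)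
    (hq : ∀ t : ℝ, q t =
      ![w₀ * Real.cos (α * t) - x₀ * Real.sin (α * t),
        w₀ * Real.sin (α * t) + x₀ * Real.cos (α * t),
        y₀ * Real.cos (β * t) - z₀ * Real.sin (β * t),
        y₀ * Real.sin (β * t) + z₀ * Real.cos (β * t)]) :
    (∃ A B C D : ℝ, ¬ (A = 0 ∧ B = 0 ∧ C = 0 ∧ D = 0) ∧
        ∀ t : ℝ, A * q t 0 + B * q t 1 + C * q t 2 + D * q t 3 = 0) ↔
      ((w₀ = 0 ∧ x₀ = 0 ∧ y₀ ^ 2 + z₀ ^ 2 = 1) ∨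
       (y₀ = 0 ∧ z₀ = 0 ∧ w₀ ^ 2 + x₀ ^ 2 = 1)) := by
  constructor
  · rintro ⟨A, B, C, D, hne, h⟩
    have hsum : ∀ t : ℝ, (A * w₀ + B * x₀) * cos (α * t) + (B * w₀ - A * x₀) * sin (α * t) +
        ((C * y₀ + D * z₀) * cos (β * t) + (D * y₀ - C * z₀) * sin (β * t)) = 0 := by
      intro t
      have ht := h t
      simp only [hq t, Matrix.cons_val] at ht
      linear_combination ht
    have hfst := sinusoid_eq_zero_of_add_eq_zero hβ hirr hsum
    obtain ⟨ha, hb⟩ := coeffs_eq_zero_of_sinusoid_eq_zero hα hfst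
    obtain ⟨hc, hd⟩ := coeffs_eq_zero_of_sinusoid_eq_zero
      (a := C * y₀ + D * z₀) (b := D * y₀ - C * z₀) hβ (fun t ↦ by linear_combination hsum t - hfst t)
    by_cases hwx : w₀ = 0 ∧ x₀ = 0
    · obtain ⟨rfl, rfl⟩ := hwx
      exact Or.inl ⟨rfl, rfl, by linear_combination hp⟩
    by_cases hyz : y₀ = 0 ∧ z₀ = 0
    · obtain ⟨rfl, rfl⟩ := hyz
      exact Or.inr ⟨rfl, rfl, by linear_combination hp⟩
    obtain ⟨hA, hB⟩ := eq_zero_of_rotated_coeffs_eq_zero hwx ha hb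
    obtain ⟨hC, hD⟩ := eq_zero_of_rotated_coeffs_eq_zero hyz hc hd
    exact absurd ⟨hA, hB, hC, hD⟩ hne
  · rintro (⟨rfl, rfl, -⟩ | ⟨rfl, rfl, -⟩)
    · exact ⟨1, 0, 0, 0, by simp, fun t ↦ by simp [hq t]⟩
    · exact ⟨0, 0, 1, 0, by simp, fun t ↦ by simp [hq t]⟩
end

section
/- Let α, β be nonzero real numbers with α/β irrational, and for p = (w₀, x₀, y₀, z₀) on the unit sphere S³ = {q ∈ ℝ⁴ : q·q = 1} define the curve 𝔮(t) = (w₀·cos(αt) − x₀·sin(αt), w₀·sin(αt) + x₀·cos(αt), y₀·cos(βt) − z₀·sin(βt), y₀·sin(βt) + z₀·cos(βt)). Then there exists a 2-dimensional linear subspace V of ℝ⁴ with 𝔮(t) ∈ V for all t ∈ ℝ if and only if p ∈ C₁ ∪ C₂, where C₁ = {(0,0,y,z) : y² + z² = 1} and C₂ = {(w,x,0,0) : w² + x² = 1}. -/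
/-- A subspace containing `n` linearly independent vectors has dimension at least `n`. -/
lemma LinearIndependent.le_finrank_of_mem {E : Type*} [AddCommGroup E] [Module ℝ E]
    [FiniteDimensional ℝ E] {n : ℕ} {V : Submodule ℝ E} {v : Fin n → E}
    (hv : LinearIndependent ℝ v) (hV : ∀ i, v i ∈ V) :
    n ≤ Module.finrank ℝ V := by
  have h := Submodule.finrank_mono (Submodule.span_le.2 (Set.range_subset_iff.2 hV))
  rwa [finrank_span_eq_card hv, Fintype.card_fin] at h

/-- If every `f t` is a combination of independent `u` and `v`, some plane contains all `f t`. -/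
lemma exists_finrank_two_of_linearIndependent_pair {E : Type*} [AddCommGroup E]
    [Module ℝ E] {u v : E}
    (huv : LinearIndependent ℝ ![u, v]) (f : ℝ → E)
    (hf : ∀ t, ∃ a b : ℝ, a • u + b • v = f t) :
    ∃ V : Submodule ℝ E, Module.finrank ℝ V = 2 ∧ ∀ t, f t ∈ V := by
  refine ⟨Submodule.span ℝ (Set.range ![u, v]), by simpa using finrank_span_eq_card huv,
    fun t => ?_⟩
  rw [Matrix.range_cons_cons_empty]
  exact Submodule.mem_span_pair.2 (hf t)

lemma linearIndependent_rotated_pair_and_complement {w x y z : ℝ}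
    (hwx : w ^ 2 + x ^ 2 ≠ 0) (hyz : y ^ 2 + z ^ 2 ≠ 0) :
    LinearIndependent ℝ ![![w, x, 0, 0], ![-x, w, 0, 0], ![0, 0, y, z]] := by
  rw [Fintype.linearIndependent_iff]
  intro g hg
  have h0 := congrFun hg 0
  have h1 := congrFun hg 1
  have h2 := congrFun hg 2
  have h3 := congrFun hg 3
  simp [Fin.sum_univ_three] at h0 h1 h2 h3
  have k0 : g 0 = 0 := by
    refine (mul_eq_zero.1 ?_).resolve_right hwx
    linear_combination w * h0 + x * h1
  have k1 : g 1 = 0 := by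
    refine (mul_eq_zero.1 ?_).resolve_right hwx
    linear_combination w * h1 - x * h0
  have k2 : g 2 = 0 := by
    refine (mul_eq_zero.1 ?_).resolve_right hyz
    rcases h2 with h | h <;> rcases h3 with h' | h' <;> simp [h, h']
  intro i
  fin_cases i <;> assumption

lemma cos_mul_two_pi_div_ne_one {α β : ℝ} (hirr : Irrational (α / β)) :
    Real.cos (α * (2 * Real.pi / β)) ≠ 1 := by
  intro h
  obtain ⟨n, hn⟩ := (Real.cos_eq_one_iff _).1 h
  refine hirr.ne_int n (mul_right_cancel₀ Real.two_pi_pos.ne' ?_)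
  rw [hn]
  ring

/-- For a point `p = (w₀,x₀,y₀,z₀)` of the unit sphere `S³ ⊂ ℝ⁴` and `α, β ≠ 0` with
`α/β` irrational, the rotated curve `𝔮(t)` lies in some 2-dimensional linear subspace of
`ℝ⁴` (i.e. traces a geodesic of `S³`) if and only if `p` lies on one of the complementary
great circles `C₁ = {(0,0,y,z) : y² + z² = 1}` and `C₂ = {(w,x,0,0) : w² + x² = 1}`. -/
theorem orbit_on_geodesic_iff_on_complementary_circle
    (α β : ℝ) (hα : α ≠ 0) (hβ : β ≠ 0) (hirr : Irrational (α / β))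
    (w₀ x₀ y₀ z₀ : ℝ) (hp : w₀ ^ 2 + x₀ ^ 2 + y₀ ^ 2 + z₀ ^ 2 = 1)
    (q : ℝ → Fin 4 → ℝ)
    (hq : ∀ t : ℝ, q t =
      ![w₀ * Real.cos (α * t) - x₀ * Real.sin (α * t),
        w₀ * Real.sin (α * t) + x₀ * Real.cos (α * t),
        y₀ * Real.cos (β * t) - z₀ * Real.sin (β * t),
        y₀ * Real.sin (β * t) + z₀ * Real.cos (β * t)]) :
    (∃ V : Submodule ℝ (Fin 4 → ℝ), Module.finrank ℝ V = 2 ∧ ∀ t : ℝ, q t ∈ V) ↔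
      ((w₀ = 0 ∧ x₀ = 0 ∧ y₀ ^ 2 + z₀ ^ 2 = 1) ∨
       (y₀ = 0 ∧ z₀ = 0 ∧ w₀ ^ 2 + x₀ ^ 2 = 1)) := by
  constructor
  · rintro ⟨V, hV, hmem⟩
    have hsplit : ∀ t, ![w₀ * Real.cos (α * t) - x₀ * Real.sin (α * t),
        w₀ * Real.sin (α * t) + x₀ * Real.cos (α * t), 0, 0] ∈ V := by
      intro t
      set s := 2 * Real.pi / β with hs
      have hβs : β * s = 2 * Real.pi := by rw [hs]; field_simp
      have hc : 2 * (Real.cos (α * s) - 1) ≠ 0 :=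
        mul_ne_zero two_ne_zero (sub_ne_zero.2 (cos_mul_two_pi_div_ne_one hirr))
      rw [← V.smul_mem_iff hc]
      convert V.sub_mem (V.add_mem (hmem (t + s)) (hmem (t - s))) (V.smul_mem 2 (hmem t)) using 1
      simp only [hq, mul_add, mul_sub, hβs, Real.cos_add, Real.sin_add, Real.cos_sub,
        Real.sin_sub, Real.cos_two_pi, Real.sin_two_pi]
      ext i
      fin_cases i <;> simp <;> ring
    have h0 : ![w₀, x₀, 0, 0] ∈ V := by simpa using hsplit 0
    have h1 : ![-x₀, w₀, 0, 0] ∈ V := by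
      have := hsplit (Real.pi / 2 / α)
      rw [mul_div_cancel₀ _ hα] at this
      simpa using this
    have h2 : ![0, 0, y₀, z₀] ∈ V := by
      convert V.sub_mem (hmem 0) h0 using 1
      rw [hq]
      ext i
      fin_cases i <;> simp
    by_cases hwx : w₀ ^ 2 + x₀ ^ 2 = 0
    · exact Or.inl ⟨by nlinarith, by nlinarith, by linarith⟩
    by_cases hyz : y₀ ^ 2 + z₀ ^ 2 = 0
    · exact Or.inr ⟨by nlinarith, by nlinarith, by linarith⟩
    have h3 := (linearIndependent_rotated_pair_and_complement hwx hyz).le_finrank_of_mem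
      (V := V) (by intro i; fin_cases i <;> assumption)
    omega
  · rintro (⟨rfl, rfl, -⟩ | ⟨rfl, rfl, -⟩)
    · refine exists_finrank_two_of_linearIndependent_pair
        (u := ![0, 0, 1, 0]) (v := ![0, 0, 0, 1]) ?_ q fun t => ⟨q t 2, q t 3, ?_⟩
      · refine LinearIndependent.pair_iff.2 fun a b h => ⟨?_, ?_⟩
        · simpa using congrFun h 2
        · simpa using congrFun h 3
      · rw [hq]
        ext i
        fin_cases i <;> simp
    · refine exists_finrank_two_of_linearIndependent_pair
        (u := ![1, 0, 0, 0]) (v := ![0, 1, 0, 0]) ?_ q fun t => ⟨q t 0, q t 1, ?_⟩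
      · refine LinearIndependent.pair_iff.2 fun a b h => ⟨?_, ?_⟩
        · simpa using congrFun h 0
        · simpa using congrFun h 1
      · rw [hq]
        ext i
        fin_cases i <;> simp
end

section
/- Fix m > 0 and nonzero real numbers α, β, and define six curves q₁,…,q₆ : ℝ → ℝ⁴ by q_k(t) = (cos(αt + 2π(k−1)/3), sin(αt + 2π(k−1)/3), 0, 0) for k = 1, 2, 3 and q_k(t) = (0, 0, cos(βt + 2π(k−4)/3), sin(βt + 2π(k−4)/3)) for k = 4, 5, 6. Then for every i = 1,…,6 and all t ∈ ℝ: q_i(t)·q_i(t) = 1, q_i(t)·q̇_i(t) = 0, and q̈_i(t) = Σ_{j≠i} m·(q_j(t) − (q_i(t)·q_j(t))·q_i(t)) / (1 − (q_i(t)·q_j(t))²)^{3/2} − (q̇_i(t)·q̇_i(t))·q_i(t); that is, the six curves form a solution of the curved 6-body problem in S³ with all six masses equal to m. -/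
/-- Euclidean inner product on `ℝ⁴`. -/
noncomputable def dot (a b : Fin 4 → ℝ) : ℝ := ∑ i, a i * b i

/-- A uniform rotation along the great circle spanned by an orthonormal pair `u`, `v` is a
geodesic of the unit sphere. -/
theorem uniform_rotation_geodesic {u v : Fin 4 → ℝ} (huu : dot u u = 1) (hvv : dot v v = 1)
    (huv : dot u v = 0) (ω φ : ℝ) {p : ℝ → Fin 4 → ℝ}
    (hp : ∀ t, p t = Real.cos (ω * t + φ) • u + Real.sin (ω * t + φ) • v) (t : ℝ) :
    dot (p t) (p t) = 1 ∧ dot (p t) (deriv p t) = 0 ∧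
      deriv (deriv p) t = -(dot (deriv p t) (deriv p t) • p t) := by
  have hθ (t : ℝ) : HasDerivAt (fun t => ω * t + φ) ω t := by
    simpa using ((hasDerivAt_id t).const_mul ω).add_const φ
  have hd : deriv p = fun t =>
      (-Real.sin (ω * t + φ) * ω) • u + (Real.cos (ω * t + φ) * ω) • v := by
    funext t
    rw [funext hp]
    exact (((hθ t).cos.smul_const u).add ((hθ t).sin.smul_const v)).deriv
  have hdd : deriv (deriv p) t =
      (-(Real.cos (ω * t + φ) * ω) * ω) • u + (-Real.sin (ω * t + φ) * ω * ω) • v := by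
    rw [hd]
    exact ((((hθ t).sin.neg.mul_const ω).smul_const u).add
      (((hθ t).cos.mul_const ω).smul_const v)).deriv.trans (by simp)
  have hsc := Real.sin_sq_add_cos_sq (ω * t + φ)
  have hdot (a b c d : ℝ) : dot (a • u + b • v) (c • u + d • v) = a * c + b * d := by
    simp only [dot, Fin.sum_univ_four, Pi.add_apply, Pi.smul_apply, smul_eq_mul] at *
    linear_combination a * c * huu + b * d * hvv + (a * d + b * c) * huv
  rw [hdd, hd, hp t]
  simp only [hdot]
  refine ⟨by linear_combination hsc, by ring, ?_⟩
  have hsq : -Real.sin (ω * t + φ) * ω * (-Real.sin (ω * t + φ) * ω) +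
      Real.cos (ω * t + φ) * ω * (Real.cos (ω * t + φ) * ω) = ω ^ 2 := by
    linear_combination ω ^ 2 * hsc
  rw [hsq]
  module

/-- The gravitational forces vanish on two equilateral triangles lying in complementary planes. -/
theorem complementary_triangles_force_eq_zero (m : ℝ) {p : Fin 6 → Fin 4 → ℝ}
    (h₁ : p 0 + p 1 + p 2 = 0) (h₂ : p 3 + p 4 + p 5 = 0)
    (hdot : ∀ i j, dot (p i) (p j) = if i = j then 1 else if i < 3 ↔ j < 3 then -1 / 2 else 0)
    (i : Fin 6) :
    ∑ j ∈ Finset.univ.erase i, (m / (1 - dot (p i) (p j) ^ 2) ^ ((3 : ℝ) / 2)) •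
      (p j - dot (p i) (p j) • p i) = 0 := by
  have hp₂ : p 2 = -p 0 - p 1 := by rw [← sub_eq_zero, ← h₁]; abel
  have hp₅ : p 5 = -p 3 - p 4 := by rw [← sub_eq_zero, ← h₂]; abel
  rw [Finset.sum_erase _ (by simp [hdot]), Fin.sum_univ_six]
  simp only [hdot]
  fin_cases i <;> simp [Fin.ext_iff, Fin.lt_def] <;> rw [hp₂, hp₅] <;> module

/-- Two equilateral triangles of equal masses `m`, rotating with frequencies `α` and `β`
along the complementary great circles `C₂ = {(w,x,0,0)}` and `C₁ = {(0,0,y,z)}`, form a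
solution of the curved 6-body problem in `S³`: the constraints `qᵢ·qᵢ = 1`,
`qᵢ·q̇ᵢ = 0` hold and the equations of motion
`q̈ᵢ = Σ_{j≠i} m·(q_j − (qᵢ·q_j)·qᵢ)/(1 − (qᵢ·q_j)²)^{3/2} − (q̇ᵢ·q̇ᵢ)·qᵢ`
are satisfied. -/
theorem six_body_solution_in_S3 (m α β : ℝ) (hm : 0 < m) (hα : α ≠ 0) (hβ : β ≠ 0)
    (q : Fin 6 → ℝ → Fin 4 → ℝ)
    (hq0 : ∀ t : ℝ, q 0 t = ![Real.cos (α * t), Real.sin (α * t), 0, 0])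
    (hq1 : ∀ t : ℝ, q 1 t = ![Real.cos (α * t + 2 * Real.pi / 3),
        Real.sin (α * t + 2 * Real.pi / 3), 0, 0])
    (hq2 : ∀ t : ℝ, q 2 t = ![Real.cos (α * t + 4 * Real.pi / 3),
        Real.sin (α * t + 4 * Real.pi / 3), 0, 0])
    (hq3 : ∀ t : ℝ, q 3 t = ![0, 0, Real.cos (β * t), Real.sin (β * t)])
    (hq4 : ∀ t : ℝ, q 4 t = ![0, 0, Real.cos (β * t + 2 * Real.pi / 3),
        Real.sin (β * t + 2 * Real.pi / 3)])
    (hq5 : ∀ t : ℝ, q 5 t = ![0, 0, Real.cos (β * t + 4 * Real.pi / 3),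
        Real.sin (β * t + 4 * Real.pi / 3)]) :
    ∀ (i : Fin 6) (t : ℝ),
      dot (q i t) (q i t) = 1 ∧
      dot (q i t) (deriv (q i) t) = 0 ∧
      deriv (deriv (q i)) t =
        (∑ j ∈ Finset.univ.erase i,
          (m / (1 - dot (q i t) (q j t) ^ 2) ^ ((3 : ℝ) / 2)) •
            (q j t - dot (q i t) (q j t) • q i t)) -
        dot (deriv (q i) t) (deriv (q i) t) • q i t := by
  have hc₁ : Real.cos (2 * Real.pi / 3) = -1 / 2 := by
    rw [show 2 * Real.pi / 3 = Real.pi - Real.pi / 3 by ring, Real.cos_pi_sub, Real.cos_pi_div_three]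
    norm_num
  have hs₁ : Real.sin (2 * Real.pi / 3) = √3 / 2 := by
    rw [show 2 * Real.pi / 3 = Real.pi - Real.pi / 3 by ring, Real.sin_pi_sub, Real.sin_pi_div_three]
  have hc₂ : Real.cos (4 * Real.pi / 3) = -1 / 2 := by
    rw [show 4 * Real.pi / 3 = Real.pi / 3 + Real.pi by ring, Real.cos_add_pi,
      Real.cos_pi_div_three]
    norm_num
  have hs₂ : Real.sin (4 * Real.pi / 3) = -(√3 / 2) := by
    rw [show 4 * Real.pi / 3 = Real.pi / 3 + Real.pi by ring, Real.sin_add_pi,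
      Real.sin_pi_div_three]
  intro i t
  have hforce := complementary_triangles_force_eq_zero m (p := fun j => q j t)
    (by
      simp only [hq0, hq1, hq2, Real.cos_add, Real.sin_add, hc₁, hs₁, hc₂, hs₂]
      ext k; fin_cases k <;> simp <;> ring)
    (by
      simp only [hq3, hq4, hq5, Real.cos_add, Real.sin_add, hc₁, hs₁, hc₂, hs₂]
      ext k; fin_cases k <;> simp <;> ring)
    (by
      have h3 : √3 ^ 2 = 3 := Real.sq_sqrt (by norm_num)
      have hα₁ := Real.sin_sq_add_cos_sq (α * t)
      have hβ₁ := Real.sin_sq_add_cos_sq (β * t)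
      intro i j
      fin_cases i <;> fin_cases j <;>
        simp [dot, Fin.sum_univ_four, hq0, hq1, hq2, hq3, hq4, hq5, Fin.ext_iff, Fin.lt_def,
          Real.cos_add, Real.sin_add, hc₁, hs₁, hc₂, hs₂] <;> grind) i
  have hgeo : dot (q i t) (q i t) = 1 ∧ dot (q i t) (deriv (q i) t) = 0 ∧
      deriv (deriv (q i)) t = -(dot (deriv (q i) t) (deriv (q i) t) • q i t) := by
    have hrotα := uniform_rotation_geodesic (u := ![1, 0, 0, 0]) (v := ![0, 1, 0, 0])
      (by simp [dot, Fin.sum_univ_four]) (by simp [dot, Fin.sum_univ_four])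
      (by simp [dot, Fin.sum_univ_four]) α
    have hrotβ := uniform_rotation_geodesic (u := ![0, 0, 1, 0]) (v := ![0, 0, 0, 1])
      (by simp [dot, Fin.sum_univ_four]) (by simp [dot, Fin.sum_univ_four])
      (by simp [dot, Fin.sum_univ_four]) β
    fin_cases i
    · exact hrotα 0 (fun t => by simp [hq0]) t
    · exact hrotα (2 * Real.pi / 3) (fun t => by simp [hq1]) t
    · exact hrotα (4 * Real.pi / 3) (fun t => by simp [hq2]) t
    · exact hrotβ 0 (fun t => by simp [hq3]) t
    · exact hrotβ (2 * Real.pi / 3) (fun t => by simp [hq4]) t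
    · exact hrotβ (4 * Real.pi / 3) (fun t => by simp [hq5]) t
  refine ⟨hgeo.1, hgeo.2.1, ?_⟩
  rw [hforce, zero_sub]
  exact hgeo.2.2
end

section
/- Fix m > 0, r ∈ (0,1), and y, z ∈ ℝ with r² + y² + z² = 1, and let ω ∈ ℝ satisfy ω² = 8m / (√3 · r³ · (4 − 3r²)^{3/2}). Define three curves q₁, q₂, q₃ : ℝ → ℝ⁴ by q_k(t) = (r·cos(ωt + 2π(k−1)/3), r·sin(ωt + 2π(k−1)/3), y, z) for k = 1, 2, 3. Then for every i and all t ∈ ℝ: q_i(t)·q_i(t) = 1, q_i(t)·q̇_i(t) = 0, and q̈_i(t) = Σ_{j≠i} m·(q_j(t) − (q_i(t)·q_j(t))·q_i(t)) / (1 − (q_i(t)·q_j(t))²)^{3/2} − (q̇_i(t)·q̇_i(t))·q_i(t); that is, the three curves form a Lagrangian elliptic relative equilibrium of the curved 3-body problem in S³ with equal masses m. -/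
/-- The point with phase `θ` on the circle of radius `r` in the plane at height `(y, z)`. -/
noncomputable def circlePoint (r y z θ : ℝ) : Fin 4 → ℝ :=
  ![r * Real.cos θ, r * Real.sin θ, y, z]

theorem dot_circlePoint (r y z θ η : ℝ) :
    dot (circlePoint r y z θ) (circlePoint r y z η) =
      r ^ 2 * Real.cos (θ - η) + y ^ 2 + z ^ 2 := by
  simp only [dot, circlePoint, Fin.sum_univ_four, Real.cos_sub, Matrix.cons_val]
  ring

theorem hasDerivAt_circlePoint (r y z ω φ t : ℝ) :
    HasDerivAt (fun s => circlePoint r y z (ω * s + φ))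
      (ω • circlePoint r 0 0 (ω * t + (φ + Real.pi / 2))) t := by
  have hlin : HasDerivAt (fun s : ℝ => ω * s + φ) ω t := by
    simpa using ((hasDerivAt_id t).const_mul ω).add_const φ
  rw [hasDerivAt_pi]
  intro k
  fin_cases k
  · simpa [circlePoint, ← add_assoc, Real.cos_add_pi_div_two, mul_comm, mul_left_comm] using
      hlin.cos.const_mul r
  · simpa [circlePoint, ← add_assoc, Real.sin_add_pi_div_two, mul_comm, mul_left_comm] using
      hlin.sin.const_mul r
  · simpa [circlePoint] using hasDerivAt_const t y
  · simpa [circlePoint] using hasDerivAt_const t z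

theorem deriv_circlePoint (r y z ω φ : ℝ) :
    deriv (fun s => circlePoint r y z (ω * s + φ)) =
      fun t => ω • circlePoint r 0 0 (ω * t + (φ + Real.pi / 2)) :=
  funext fun t => (hasDerivAt_circlePoint r y z ω φ t).deriv

theorem deriv_deriv_circlePoint (r y z ω φ t : ℝ) :
    deriv (deriv (fun s => circlePoint r y z (ω * s + φ))) t =
      -ω ^ 2 • circlePoint r 0 0 (ω * t + φ) := by
  rw [deriv_circlePoint]
  refine ((hasDerivAt_circlePoint r 0 0 ω (φ + Real.pi / 2) t).const_smul ω).deriv.trans ?_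
  have h : ω * t + (φ + Real.pi / 2 + Real.pi / 2) = ω * t + φ + Real.pi := by ring
  rw [h]
  ext k
  fin_cases k <;> simp [circlePoint] <;> ring

theorem cos_two_pi_div_three : Real.cos (2 * Real.pi / 3) = -1 / 2 := by
  rw [show 2 * Real.pi / 3 = Real.pi - Real.pi / 3 by ring, Real.cos_pi_sub, Real.cos_pi_div_three]
  norm_num

theorem cos_four_pi_div_three : Real.cos (4 * Real.pi / 3) = -1 / 2 := by
  rw [show 4 * Real.pi / 3 = Real.pi / 3 + Real.pi by ring, Real.cos_add_pi,
    Real.cos_pi_div_three]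
  norm_num

theorem sin_four_pi_div_three :
    Real.sin (4 * Real.pi / 3) = -Real.sin (2 * Real.pi / 3) := by
  rw [← Real.sin_two_pi_sub]
  congr 1
  ring

/-- The centre of an equilateral triangle inscribed in a circle is the centre of the circle. -/
theorem circlePoint_add_add (r y z θ : ℝ) :
    circlePoint r y z θ + circlePoint r y z (θ + 2 * Real.pi / 3) +
      circlePoint r y z (θ + 4 * Real.pi / 3) = ![0, 0, 3 * y, 3 * z] := by
  ext k
  fin_cases k <;>
    simp [circlePoint, Real.cos_add, Real.sin_add, cos_two_pi_div_three,
      cos_four_pi_div_three, sin_four_pi_div_three] <;> ring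

/-- The strength of the pairwise interaction in the equilateral configuration. -/
theorem interaction_strength {m r ω : ℝ} (hr : r ∈ Set.Ioo (0 : ℝ) 1)
    (hω : ω ^ 2 = 8 * m / (Real.sqrt 3 * r ^ 3 * (4 - 3 * r ^ 2) ^ ((3 : ℝ) / 2))) :
    m / (1 - (1 - 3 * r ^ 2 / 2) ^ 2) ^ ((3 : ℝ) / 2) = ω ^ 2 / 3 := by
  obtain ⟨h0, h1⟩ := hr
  have hpos : 0 < 4 - 3 * r ^ 2 := by nlinarith
  have hfac : 1 - (1 - 3 * r ^ 2 / 2) ^ 2 = (Real.sqrt 3 * r / 2) ^ 2 * (4 - 3 * r ^ 2) := by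
    rw [div_pow, mul_pow, Real.sq_sqrt (by norm_num)]
    ring
  have hpow : ((Real.sqrt 3 * r / 2) ^ 2) ^ ((3 : ℝ) / 2) = (Real.sqrt 3 * r / 2) ^ 3 := by
    rw [← Real.rpow_natCast, ← Real.rpow_mul (by positivity), ← Real.rpow_natCast]
    norm_num
  have hsqrt : Real.sqrt 3 ^ 3 = 3 * Real.sqrt 3 := by
    rw [pow_succ, Real.sq_sqrt (by norm_num)]
  rw [hfac, Real.mul_rpow (by positivity) hpos.le, hpow, hω, div_pow, mul_pow, hsqrt]
  have := Real.rpow_pos_of_pos hpos ((3 : ℝ) / 2)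
  field_simp
  norm_num

/-- The force and the constraint reaction add up to the centripetal acceleration. -/
theorem equilateral_force_balance {r y z K θ : ℝ} {a b : Fin 4 → ℝ}
    (hab : circlePoint r y z θ + a + b = ![0, 0, 3 * y, 3 * z]) :
    -(3 * K) • circlePoint r 0 0 θ =
      K • (a - (1 - 3 * r ^ 2 / 2) • circlePoint r y z θ) +
        K • (b - (1 - 3 * r ^ 2 / 2) • circlePoint r y z θ) -
      (3 * K * r ^ 2) • circlePoint r y z θ := by
  have hb : b = ![0, 0, 3 * y, 3 * z] - circlePoint r y z θ - a := by
    rw [← hab]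
    abel
  rw [hb]
  ext k
  fin_cases k <;> simp [circlePoint] <;> ring

/-- For equal masses `m`, radius `r ∈ (0,1)` with `r² + y² + z² = 1` and frequency `ω`
with `ω² = 8m/(√3·r³·(4 − 3r²)^{3/2})`, the three bodies at the vertices of a rotating
equilateral triangle form a Lagrangian elliptic relative equilibrium of the curved
3-body problem in `S³`: the constraints `qᵢ·qᵢ = 1`, `qᵢ·q̇ᵢ = 0` hold and the equations
of motion `q̈ᵢ = Σ_{j≠i} m·(q_j − (qᵢ·q_j)·qᵢ)/(1 − (qᵢ·q_j)²)^{3/2} − (q̇ᵢ·q̇ᵢ)·qᵢ`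
are satisfied. -/
theorem lagrangian_elliptic_relative_equilibrium (m r y z ω : ℝ)
    (hm : 0 < m) (hr : r ∈ Set.Ioo (0 : ℝ) 1) (hsum : r ^ 2 + y ^ 2 + z ^ 2 = 1)
    (hω : ω ^ 2 = 8 * m / (Real.sqrt 3 * r ^ 3 * (4 - 3 * r ^ 2) ^ ((3 : ℝ) / 2)))
    (q : Fin 3 → ℝ → Fin 4 → ℝ)
    (hq0 : ∀ t : ℝ, q 0 t = ![r * Real.cos (ω * t), r * Real.sin (ω * t), y, z])
    (hq1 : ∀ t : ℝ, q 1 t = ![r * Real.cos (ω * t + 2 * Real.pi / 3),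
        r * Real.sin (ω * t + 2 * Real.pi / 3), y, z])
    (hq2 : ∀ t : ℝ, q 2 t = ![r * Real.cos (ω * t + 4 * Real.pi / 3),
        r * Real.sin (ω * t + 4 * Real.pi / 3), y, z]) :
    ∀ (i : Fin 3) (t : ℝ),
      dot (q i t) (q i t) = 1 ∧
      dot (q i t) (deriv (q i) t) = 0 ∧
      deriv (deriv (q i)) t =
        (∑ j ∈ Finset.univ.erase i,
          (m / (1 - dot (q i t) (q j t) ^ 2) ^ ((3 : ℝ) / 2)) •
            (q j t - dot (q i t) (q j t) • q i t)) -
        dot (deriv (q i) t) (deriv (q i) t) • q i t := by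
  have hq : ∀ i, q i = fun t => circlePoint r y z
      (ω * t + ![0, 2 * Real.pi / 3, 4 * Real.pi / 3] i) := by
    intro i
    funext t
    fin_cases i <;> simp [circlePoint, hq0, hq1, hq2]
  have hcos : ∀ i j : Fin 3, i ≠ j → ∀ t,
      dot (q i t) (q j t) = 1 - 3 * r ^ 2 / 2 := by
    intro i j hij t
    have hangle : Real.cos (![0, 2 * Real.pi / 3, 4 * Real.pi / 3] i -
        ![0, 2 * Real.pi / 3, 4 * Real.pi / 3] j) = -1 / 2 := by
      have h1 : 2 * Real.pi / 3 - 4 * Real.pi / 3 = -(2 * Real.pi / 3) := by ring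
      have h2 : 4 * Real.pi / 3 - 2 * Real.pi / 3 = 2 * Real.pi / 3 := by ring
      fin_cases i <;> fin_cases j <;>
        simp [cos_two_pi_div_three, cos_four_pi_div_three, h1, h2] at hij ⊢
    rw [hq, hq, dot_circlePoint, add_sub_add_left_eq_sub, hangle]
    linarith
  have hsum3 : ∀ t, q 0 t + q 1 t + q 2 t = ![0, 0, 3 * y, 3 * z] := by
    intro t
    simpa [hq] using circlePoint_add_add r y z (ω * t)
  have hK := interaction_strength hr hω
  intro i t
  have hvel : dot (deriv (q i) t) (deriv (q i) t) = 3 * (ω ^ 2 / 3) * r ^ 2 := by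
    rw [hq, deriv_circlePoint]
    have := dot_circlePoint r 0 0 (ω * t + (![0, 2 * Real.pi / 3, 4 * Real.pi / 3] i +
      Real.pi / 2)) (ω * t + (![0, 2 * Real.pi / 3, 4 * Real.pi / 3] i + Real.pi / 2))
    simp only [dot, Fin.sum_univ_four, Pi.smul_apply, smul_eq_mul, sub_self, Real.cos_zero]
      at this ⊢
    linear_combination ω ^ 2 * this
  refine ⟨?_, ?_, ?_⟩
  · rw [hq, dot_circlePoint, sub_self, Real.cos_zero]
    linarith
  · rw [hq, deriv_circlePoint]
    simp [dot, circlePoint, Fin.sum_univ_four, ← add_assoc, Real.cos_add_pi_div_two,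
      Real.sin_add_pi_div_two]
    ring
  · have hacc : deriv (deriv (q i)) t = -(3 * (ω ^ 2 / 3)) •
        circlePoint r 0 0 (ω * t + ![0, 2 * Real.pi / 3, 4 * Real.pi / 3] i) := by
      rw [hq, deriv_deriv_circlePoint, mul_div_cancel₀ _ (three_ne_zero)]
    have hbal : ∀ j k : Fin 3, q i t + q j t + q k t = ![0, 0, 3 * y, 3 * z] → i ≠ j → i ≠ k →
        j ≠ k → Finset.univ.erase i = {j, k} →
        deriv (deriv (q i)) t = (∑ j ∈ Finset.univ.erase i,
          (m / (1 - dot (q i t) (q j t) ^ 2) ^ ((3 : ℝ) / 2)) •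
            (q j t - dot (q i t) (q j t) • q i t)) -
          dot (deriv (q i) t) (deriv (q i) t) • q i t := by
      intro j k hjk hij hik hne herase
      rw [herase, Finset.sum_pair hne, hcos i j hij, hcos i k hik, hK, hvel, hacc]
      rw [hq i] at hjk ⊢
      exact equilateral_force_balance hjk
    fin_cases i
    · exact hbal 1 2 (hsum3 t) (by decide) (by decide) (by decide) (by decide)
    · exact hbal 0 2 (by rw [← hsum3 t]; simp only [Fin.mk_one]; abel)
        (by decide) (by decide) (by decide) (by decide)
    · exact hbal 0 1 (by rw [← hsum3 t]; simp only [Fin.reduceFinMk]; abel)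
        (by decide) (by decide) (by decide) (by decide)
end

section
/- Let N ≥ 2, let m₁,…,m_N > 0, and let q₁,…,q_N : ℝ → ℝ⁴ be twice differentiable curves such that for all t ∈ ℝ: q_i(t)·q_i(t) = 1 and q_i(t)·q̇_i(t) = 0 for each i, (q_i(t)·q_j(t))² ≠ 1 for all i ≠ j, and q̈_i(t) = Σ_{j≠i} m_j·(q_j(t) − (q_i(t)·q_j(t))·q_i(t)) / (1 − (q_i(t)·q_j(t))²)^{3/2} − (q̇_i(t)·q̇_i(t))·q_i(t). Then the total energy t ↦ (1/2)·Σ_{i=1}^{N} m_i·(q̇_i(t)·q̇_i(t)) − Σ_{1 ≤ i < j ≤ N} m_i·m_j·(q_i(t)·q_j(t)) / (1 − (q_i(t)·q_j(t))²)^{1/2} is constant on ℝ. -/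
lemma dot_eq_dotProduct (a b : Fin 4 → ℝ) : dot a b = a ⬝ᵥ b := rfl

lemma dot_comm (a b : Fin 4 → ℝ) : dot a b = dot b a := dotProduct_comm a b

lemma dot_sq_le (a b : Fin 4 → ℝ) : dot a b ^ 2 ≤ dot a a * dot b b := by
  simpa only [dot, sq] using Finset.sum_mul_sq_le_sq_mul_sq Finset.univ a b

lemma HasDerivAt.dot {f g : ℝ → Fin 4 → ℝ} {f' g' : Fin 4 → ℝ} {t : ℝ}
    (hf : HasDerivAt f f' t) (hg : HasDerivAt g g' t) :
    HasDerivAt (fun s => dot (f s) (g s)) (dot f' (g t) + dot (f t) g') t := by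
  simp only [_root_.dot, ← Finset.sum_add_distrib]
  exact HasDerivAt.fun_sum fun k _ => (hasDerivAt_pi.1 hf k).mul (hasDerivAt_pi.1 hg k)

/-- The derivative of `x ↦ x / √(1 - x²)`, the cotangent in terms of the cosine. -/
lemma HasDerivAt.div_one_sub_sq_rpow_half {c : ℝ → ℝ} {c' t : ℝ}
    (hc : HasDerivAt c c' t) (hpos : 0 < 1 - c t ^ 2) :
    HasDerivAt (fun s => c s / (1 - c s ^ 2) ^ ((1 : ℝ) / 2))
      (c' / (1 - c t ^ 2) ^ ((3 : ℝ) / 2)) t := by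
  have hroot := ((hc.fun_pow 2).const_sub 1).rpow_const (p := (1 : ℝ) / 2) (Or.inl hpos.ne')
  refine (hc.fun_div hroot (Real.rpow_pos_of_pos hpos _).ne').congr_deriv ?_
  have h_three_halves : (1 - c t ^ 2) ^ ((3 : ℝ) / 2) =
      (1 - c t ^ 2) * (1 - c t ^ 2) ^ ((1 : ℝ) / 2) := by
    rw [← Real.rpow_one_add' hpos.le (by norm_num)]
    norm_num
  have h_neg_half : (1 - c t ^ 2) ^ ((1 : ℝ) / 2 - 1) =
      (1 - c t ^ 2) ^ ((1 : ℝ) / 2) / (1 - c t ^ 2) := Real.rpow_sub_one hpos.ne' _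
  have hroot_pos : 0 < (1 - c t ^ 2) ^ ((1 : ℝ) / 2) := Real.rpow_pos_of_pos hpos _
  rw [h_three_halves, h_neg_half]
  generalize (1 - c t ^ 2) ^ ((1 : ℝ) / 2) = r at hroot_pos
  field_simp
  ring

/-- A sum over ordered pairs of distinct indices, grouped into unordered pairs. -/
lemma sum_sum_erase_eq_sum_sum_lt {ι M : Type*} [Fintype ι] [LinearOrder ι] [AddCommMonoid M]
    (F : ι → ι → M) :
    ∑ i, ∑ j ∈ Finset.univ.erase i, F i j =
      ∑ i, ∑ j ∈ Finset.univ.filter (fun j => i < j), (F i j + F j i) := by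
  have hsplit (i : ι) : ∑ j ∈ Finset.univ.erase i, F i j =
      ∑ j ∈ Finset.univ.filter (fun j => i < j), F i j +
        ∑ j ∈ Finset.univ.filter (fun j => j < i), F i j := by
    rw [← Finset.sum_union]
    · congr 1
      ext j
      simp [lt_or_lt_iff_ne, eq_comm]
    · exact Finset.disjoint_filter.2 fun j _ h h' => lt_asymm h h'
  simp only [hsplit, Finset.sum_add_distrib]
  congr 1
  exact Finset.sum_comm' (by simp)

/-- Energy integral of the curved `N`-body problem in `S³`: along any twice differentiable
solution of `q̈ᵢ = Σ_{j≠i} m_j·(q_j − (qᵢ·q_j)·qᵢ)/(1 − (qᵢ·q_j)²)^{3/2} − (q̇ᵢ·q̇ᵢ)·qᵢ`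
satisfying the constraints `qᵢ·qᵢ = 1`, `qᵢ·q̇ᵢ = 0` and avoiding singularities
(`(qᵢ·q_j)² ≠ 1` for `i ≠ j`), the total energy `T − U` is constant. -/
theorem curved_n_body_energy_integral (N : ℕ) (hN : 2 ≤ N)
    (m : Fin N → ℝ) (hm : ∀ i, 0 < m i)
    (q : Fin N → ℝ → Fin 4 → ℝ)
    (hdiff : ∀ i, Differentiable ℝ (q i) ∧ Differentiable ℝ (deriv (q i)))
    (hconstr₁ : ∀ (i : Fin N) (t : ℝ), dot (q i t) (q i t) = 1)
    (hconstr₂ : ∀ (i : Fin N) (t : ℝ), dot (q i t) (deriv (q i) t) = 0)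
    (hreg : ∀ (i j : Fin N) (t : ℝ), i ≠ j → dot (q i t) (q j t) ^ 2 ≠ 1)
    (heom : ∀ (i : Fin N) (t : ℝ),
      deriv (deriv (q i)) t =
        (∑ j ∈ Finset.univ.erase i,
          (m j / (1 - dot (q i t) (q j t) ^ 2) ^ ((3 : ℝ) / 2)) •
            (q j t - dot (q i t) (q j t) • q i t)) -
        dot (deriv (q i) t) (deriv (q i) t) • q i t) :
    ∀ t₁ t₂ : ℝ,
      ((1 : ℝ) / 2 * ∑ i, m i * dot (deriv (q i) t₁) (deriv (q i) t₁)) -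
        (∑ i, ∑ j ∈ Finset.univ.filter (fun j => i < j),
          m i * m j * dot (q i t₁) (q j t₁) /
            (1 - dot (q i t₁) (q j t₁) ^ 2) ^ ((1 : ℝ) / 2)) =
      ((1 : ℝ) / 2 * ∑ i, m i * dot (deriv (q i) t₂) (deriv (q i) t₂)) -
        (∑ i, ∑ j ∈ Finset.univ.filter (fun j => i < j),
          m i * m j * dot (q i t₂) (q j t₂) /
            (1 - dot (q i t₂) (q j t₂) ^ 2) ^ ((1 : ℝ) / 2)) := by
  have hpos (i j : Fin N) (hij : i ≠ j) (t : ℝ) : 0 < 1 - dot (q i t) (q j t) ^ 2 := by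
    have hle := dot_sq_le (q i t) (q j t)
    rw [hconstr₁, hconstr₁, one_mul] at hle
    exact sub_pos.2 (lt_of_le_of_ne hle (hreg i j t hij))
  have hq (i : Fin N) (t : ℝ) : HasDerivAt (q i) (deriv (q i) t) t :=
    ((hdiff i).1 t).hasDerivAt
  have hv (i : Fin N) (t : ℝ) : HasDerivAt (deriv (q i)) (deriv (deriv (q i)) t) t :=
    ((hdiff i).2 t).hasDerivAt
  have hpower (i : Fin N) (t : ℝ) : dot (deriv (q i) t) (deriv (deriv (q i)) t) =
      ∑ j ∈ Finset.univ.erase i, m j / (1 - dot (q i t) (q j t) ^ 2) ^ ((3 : ℝ) / 2) *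
        dot (deriv (q i) t) (q j t) := by
    have horth : deriv (q i) t ⬝ᵥ q i t = 0 := by
      rw [dotProduct_comm]
      exact hconstr₂ i t
    rw [heom, dot_eq_dotProduct, dotProduct_sub, dotProduct_sum, dotProduct_smul, horth,
      smul_zero, sub_zero]
    refine Finset.sum_congr rfl fun j _ => ?_
    rw [dotProduct_smul, dotProduct_sub, dotProduct_smul, horth, smul_zero, sub_zero,
      smul_eq_mul, ← dot_eq_dotProduct]
  have hkinetic (t : ℝ) :
      HasDerivAt (fun s => (1 : ℝ) / 2 * ∑ i, m i * dot (deriv (q i) s) (deriv (q i) s))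
        (∑ i, m i * dot (deriv (q i) t) (deriv (deriv (q i)) t)) t := by
    refine ((HasDerivAt.fun_sum (u := Finset.univ) fun i _ =>
      ((hv i t).dot (hv i t)).const_mul (m i)).const_mul ((1 : ℝ) / 2)).congr_deriv ?_
    rw [Finset.mul_sum]
    refine Finset.sum_congr rfl fun i _ => ?_
    rw [dot_comm (deriv (deriv (q i)) t)]
    ring
  have hpotential (t : ℝ) :
      HasDerivAt (fun s => ∑ i, ∑ j ∈ Finset.univ.filter (fun j => i < j),
          m i * m j * dot (q i s) (q j s) / (1 - dot (q i s) (q j s) ^ 2) ^ ((1 : ℝ) / 2))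
        (∑ i, ∑ j ∈ Finset.univ.filter (fun j => i < j),
          m i * m j * ((dot (deriv (q i) t) (q j t) + dot (q i t) (deriv (q j) t)) /
            (1 - dot (q i t) (q j t) ^ 2) ^ ((3 : ℝ) / 2))) t := by
    simp only [mul_div_assoc]
    refine HasDerivAt.fun_sum fun i _ => HasDerivAt.fun_sum fun j hj => ?_
    have hij : i ≠ j := (Finset.mem_filter.1 hj).2.ne
    exact (((hq i t).dot (hq j t)).div_one_sub_sq_rpow_half (hpos i j hij t)).const_mul _
  have hbalance (t : ℝ) : ∑ i, m i * dot (deriv (q i) t) (deriv (deriv (q i)) t) =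
      ∑ i, ∑ j ∈ Finset.univ.filter (fun j => i < j),
        m i * m j * ((dot (deriv (q i) t) (q j t) + dot (q i t) (deriv (q j) t)) /
          (1 - dot (q i t) (q j t) ^ 2) ^ ((3 : ℝ) / 2)) := by
    simp only [hpower, Finset.mul_sum]
    rw [sum_sum_erase_eq_sum_sum_lt]
    refine Finset.sum_congr rfl fun i _ => Finset.sum_congr rfl fun j _ => ?_
    rw [dot_comm (q j t) (q i t), dot_comm (q i t) (deriv (q j) t)]
    ring
  have henergy (t : ℝ) := (hkinetic t).fun_sub (hpotential t)
  exact is_const_of_deriv_eq_zero (fun t => (henergy t).differentiableAt) fun t => by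
    rw [(henergy t).deriv, hbalance, sub_self]
end

section
/- Let N ≥ 2, let m₁,…,m_N > 0, and let q₁,…,q_N : ℝ → ℝ⁴ be twice differentiable curves such that for all t ∈ ℝ: (q_i(t)·q_j(t))² ≠ 1 for all i ≠ j, and q̈_i(t) = Σ_{j≠i} m_j·(q_j(t) − (q_i(t)·q_j(t))·q_i(t)) / (1 − (q_i(t)·q_j(t))²)^{3/2} − (q̇_i(t)·q̇_i(t))·q_i(t). Then for every pair of coordinate indices a, b ∈ {1,2,3,4} the function t ↦ Σ_{i=1}^{N} m_i·(q_i(t)_a·q̇_i(t)_b − q_i(t)_b·q̇_i(t)_a) is constant on ℝ; that is, all six components of the total angular momentum Σ_i m_i·q_i ∧ q̇_i are conserved. -/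
theorem dot_comm_s16 (u v : Fin 4 → ℝ) : dot u v = dot v u := by
  simp only [dot, mul_comm]

/-- The double sum of an antisymmetric real function vanishes. -/
theorem sum_sum_eq_zero_of_antisymm {ι : Type*} [Fintype ι] (F : ι → ι → ℝ)
    (hF : ∀ i j, F i j = -F j i) : ∑ i, ∑ j, F i j = 0 := by
  have h : ∑ i, ∑ j, F i j = -∑ i, ∑ j, F i j := by
    conv_lhs => rw [Finset.sum_comm]
    simp only [← Finset.sum_neg_distrib]
    exact Finset.sum_congr rfl fun i _ => Finset.sum_congr rfl fun j _ => hF j i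
  linarith

/-- The derivative of a component of `q ∧ q̇` is the corresponding component of `q ∧ q̈`. -/
theorem hasDerivAt_wedge_deriv {ι : Type*} [Fintype ι] {q : ℝ → ι → ℝ} {t : ℝ}
    (hq : DifferentiableAt ℝ q t) (hq' : DifferentiableAt ℝ (deriv q) t) (a b : ι) :
    HasDerivAt (fun s => q s a * deriv q s b - q s b * deriv q s a)
      (q t a * deriv (deriv q) t b - q t b * deriv (deriv q) t a) t := by
  have h := hasDerivAt_pi.1 hq.hasDerivAt
  have h' := hasDerivAt_pi.1 hq'.hasDerivAt
  exact (((h a).mul (h' b)).sub ((h b).mul (h' a))).congr_deriv (by ring)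

/-- Angular-momentum integral of the curved `N`-body problem in `S³`: along any twice
differentiable solution of
`q̈ᵢ = Σ_{j≠i} m_j·(q_j − (qᵢ·q_j)·qᵢ)/(1 − (qᵢ·q_j)²)^{3/2} − (q̇ᵢ·q̇ᵢ)·qᵢ`
avoiding singularities (`(qᵢ·q_j)² ≠ 1` for `i ≠ j`), each of the six components
`Σᵢ mᵢ·(qᵢᵃ q̇ᵢᵇ − qᵢᵇ q̇ᵢᵃ)` of the total angular momentum `Σᵢ mᵢ·qᵢ ∧ q̇ᵢ`
is constant. -/
theorem curved_n_body_angular_momentum_integral (N : ℕ) (hN : 2 ≤ N)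
    (m : Fin N → ℝ) (hm : ∀ i, 0 < m i)
    (q : Fin N → ℝ → Fin 4 → ℝ)
    (hdiff : ∀ i, Differentiable ℝ (q i) ∧ Differentiable ℝ (deriv (q i)))
    (hreg : ∀ (i j : Fin N) (t : ℝ), i ≠ j → dot (q i t) (q j t) ^ 2 ≠ 1)
    (heom : ∀ (i : Fin N) (t : ℝ),
      deriv (deriv (q i)) t =
        (∑ j ∈ Finset.univ.erase i,
          (m j / (1 - dot (q i t) (q j t) ^ 2) ^ ((3 : ℝ) / 2)) •
            (q j t - dot (q i t) (q j t) • q i t)) -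
        dot (deriv (q i) t) (deriv (q i) t) • q i t) :
    ∀ (a b : Fin 4) (t₁ t₂ : ℝ),
      (∑ i, m i * (q i t₁ a * deriv (q i) t₁ b - q i t₁ b * deriv (q i) t₁ a)) =
      (∑ i, m i * (q i t₂ a * deriv (q i) t₂ b - q i t₂ b * deriv (q i) t₂ a)) := by
  intro a b
  refine is_const_of_deriv_eq_zero (𝕜 := ℝ)
    (f := fun t => ∑ i, m i * (q i t a * deriv (q i) t b - q i t b * deriv (q i) t a)) ?_ ?_
  all_goals
    have hderiv := fun t => HasDerivAt.fun_sum (u := Finset.univ) fun i _ =>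
      (hasDerivAt_wedge_deriv ((hdiff i).1 t) ((hdiff i).2 t) a b).const_mul (m i)
  · exact fun t => (hderiv t).differentiableAt
  intro t
  rw [(hderiv t).deriv]
  let torque : Fin N → Fin N → ℝ := fun i j =>
    m i * (m j / (1 - dot (q i t) (q j t) ^ 2) ^ ((3 : ℝ) / 2)) *
      (q i t a * q j t b - q i t b * q j t a)
  rw [← sum_sum_eq_zero_of_antisymm torque fun i j => by
    simp only [torque, dot_comm_s16 (q j t) (q i t)]; ring]
  refine Finset.sum_congr rfl fun i _ => ?_
  rw [← Finset.sum_erase Finset.univ (show torque i i = 0 by simp only [torque]; ring), heom i t]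
  simp only [Pi.sub_apply, Finset.sum_apply, Pi.smul_apply, smul_eq_mul]
  -- The constraint force is parallel to `q i t`, hence drops out of the wedge product.
  have hcancel (A B c x y : ℝ) : x * (B - c * y) - y * (A - c * x) = x * B - y * A := by ring
  rw [hcancel, Finset.mul_sum, Finset.mul_sum, ← Finset.sum_sub_distrib, Finset.mul_sum]
  refine Finset.sum_congr rfl fun j _ => ?_
  simp only [torque]
  ring
end
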